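/- For τ > 0 and ξ ≥ 0, f(ξ,τ) := (2/√π) ∫_0^∞ exp(-(u+ξ/(2√τ))²) ₀F̄₁(;1; 2ξ√τ u) du satisfies f(ξ,τ) = 1 + ξ(2τ-1)/√(πτ) + (ξ²/2)(τ-2) + O(ξ³) as ξ → 0, for fixed τ > 0. -/

import Mathlib

open Real MeasureTheory Asymptotics

/-- The regularized confluent hypergeometric limit function ₀F̄₁(;1;x) = ∑ xᵏ/(k!)². -/
noncomputable def F01reg (x : ℝ) : ℝ := ∑' k : ℕ, x ^ k / (k.factorial : ℝ) ^ 2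

lemma F_summ (y : ℝ) : Summable (fun k : ℕ => y ^ k / (k.factorial : ℝ) ^ 2) := by
  refine Summable.of_norm_bounded (g := fun k : ℕ => |y| ^ k / (k.factorial : ℝ))
    (Real.summable_pow_div_factorial _) fun k => ?_
  have h1 : (1 : ℝ) ≤ k.factorial := by exact_mod_cast k.factorial_pos
  rw [Real.norm_eq_abs, abs_div, abs_pow, abs_of_nonneg (by positivity : (0:ℝ) ≤ (k.factorial : ℝ) ^ 2)]
  gcongr
  nlinarith

lemma F_meas : Measurable F01reg := by
  refine measurable_of_tendsto_metrizable (f := fun n y => ∑ k ∈ Finset.range n, y ^ k / (k.factorial : ℝ) ^ 2)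
    (fun n => by fun_prop) ?_
  rw [tendsto_pi_nhds]
  intro y
  exact (F_summ y).hasSum.tendsto_sum_nat

lemma exp_tsum (y : ℝ) : HasSum (fun k : ℕ => y ^ k / (k.factorial : ℝ)) (Real.exp y) := by
  rw [Real.exp_eq_exp_ℝ]
  exact NormedSpace.expSeries_div_hasSum_exp y

lemma F_bd (y : ℝ) (hy : 0 ≤ y) : |F01reg y| ≤ Real.exp y := by
  have h0 : 0 ≤ F01reg y := tsum_nonneg fun k => by positivity
  rw [abs_of_nonneg h0]
  refine hasSum_le (fun k => ?_) (F_summ y).hasSum (exp_tsum y)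
  have h1 : (1 : ℝ) ≤ k.factorial := by exact_mod_cast k.factorial_pos
  gcongr
  nlinarith

lemma F_rem (y : ℝ) (hy : 0 ≤ y) : |F01reg y - (1 + y + y ^ 2 / 4)| ≤ y ^ 3 * Real.exp y := by
  have h := (F_summ y).sum_add_tsum_nat_add 3
  have h' : F01reg y - (1 + y + y ^ 2 / 4) = ∑' k : ℕ, y ^ (k + 3) / ((k + 3).factorial : ℝ) ^ 2 := by
    unfold F01reg
    rw [← h]
    norm_num [Finset.sum_range_succ, Nat.factorial]
  rw [h', abs_of_nonneg (tsum_nonneg fun k => by positivity)]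
  refine hasSum_le (fun k => ?_) ((summable_nat_add_iff 3).2 (F_summ y)).hasSum ((exp_tsum y).mul_left (y ^ 3))
  have h1 : (1 : ℝ) ≤ (k + 3).factorial := by exact_mod_cast (k + 3).factorial_pos
  have h2 : (k.factorial : ℝ) ≤ (k + 3).factorial := by exact_mod_cast Nat.factorial_le (by omega)
  have h3 : (0 : ℝ) < k.factorial := by exact_mod_cast k.factorial_pos
  rw [pow_add, mul_comm, mul_div_assoc]
  gcongr
  nlinarith

lemma exp_rem (n : ℕ) (x : ℝ) :
    |Real.exp x - ∑ m ∈ Finset.range n, x ^ m / (m.factorial : ℝ)| ≤ |x| ^ n * Real.exp |x| := by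
  have := Complex.norm_exp_sub_sum_le_norm_mul_exp (x : ℂ) n
  rw [Complex.norm_real, Real.norm_eq_abs] at this
  rw [← Real.norm_eq_abs, ← Complex.norm_real]
  push_cast
  exact this

/-- The one-variable expansion. -/
lemma phi_bd (a b : ℝ) (ha : 0 < a) (hb : 0 < b) : ∃ C K : ℝ, 0 ≤ C ∧ 0 ≤ K ∧ ∀ w : ℝ, 0 ≤ w →
    |Real.exp (-(2 * a * w)) * F01reg (b * w)
      - (1 + (b - 2 * a) * w + (b ^ 2 / 4 - 2 * a * b + 2 * a ^ 2) * w ^ 2)| ≤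
      C * (w ^ 3 * Real.exp (K * w)) := by
  set d3 : ℝ := -2 * a * (b ^ 2 / 4) + 2 * a ^ 2 * b with hd3
  set d4 : ℝ := 2 * a ^ 2 * (b ^ 2 / 4) with hd4
  refine ⟨(2 * a) ^ 3 + b ^ 3 + (|d3| + |d4|), 2 * a + b + 1, by positivity, by positivity, fun w hw => ?_⟩
  have e1 := exp_rem 3 (-(2 * a * w))
  rw [abs_neg, abs_of_nonneg (by positivity : 0 ≤ 2 * a * w)] at e1
  set P : ℝ := ∑ m ∈ Finset.range 3, (-(2 * a * w)) ^ m / (m.factorial : ℝ) with hP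
  have hP' : P = 1 - 2 * a * w + 2 * a ^ 2 * w ^ 2 := by
    rw [hP]; norm_num [Finset.sum_range_succ, Nat.factorial]; ring
  have hPb : |P| ≤ Real.exp (2 * a * w) := by
    have := Real.quadratic_le_exp_of_nonneg (by positivity : 0 ≤ 2 * a * w)
    have h0 : 0 ≤ a * w := by positivity
    rw [hP', abs_le]
    constructor <;> nlinarith [sq_nonneg (a * w)]
  have e2 := F_bd (b * w) (by positivity)
  have e3 := F_rem (b * w) (by positivity)
  set Q : ℝ := 1 + b * w + (b * w) ^ 2 / 4 with hQ
  have key : Real.exp (-(2 * a * w)) * F01reg (b * w)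
      - (1 + (b - 2 * a) * w + (b ^ 2 / 4 - 2 * a * b + 2 * a ^ 2) * w ^ 2)
      = (Real.exp (-(2 * a * w)) - P) * F01reg (b * w) + P * (F01reg (b * w) - Q)
        + w ^ 3 * (d3 + d4 * w) := by
    rw [hP', hQ, hd3, hd4]; ring
  have hsplit : Real.exp ((2 * a + b + 1) * w) = Real.exp (2 * a * w) * Real.exp (b * w) * Real.exp w := by
    rw [← Real.exp_add, ← Real.exp_add]; ring_nf
  have x1 : 1 ≤ Real.exp (2 * a * w) := Real.one_le_exp (by positivity)
  have x2 : 1 ≤ Real.exp (b * w) := Real.one_le_exp (by positivity)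
  have x3 : 1 ≤ Real.exp w := Real.one_le_exp (by positivity)
  have x4 : w ≤ Real.exp w := by linarith [Real.add_one_le_exp w]
  set A := Real.exp (2 * a * w)
  set B := Real.exp (b * w)
  set E := Real.exp w
  have x5 : 1 ≤ A * B := by nlinarith
  have x6 : A * B ≤ A * B * E := by nlinarith
  have x7 : E ≤ A * B * E := by nlinarith
  rw [key, hsplit]
  refine (abs_add_three _ _ _).trans ?_
  have t1 : |(Real.exp (-(2 * a * w)) - P) * F01reg (b * w)| ≤ (2 * a) ^ 3 * (w ^ 3 * (A * B * E)) := by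
    rw [abs_mul]
    calc _ ≤ ((2 * a * w) ^ 3 * A) * B := by gcongr
      _ = (2 * a) ^ 3 * (w ^ 3 * (A * B)) := by ring
      _ ≤ _ := by gcongr
  have t2 : |P * (F01reg (b * w) - Q)| ≤ b ^ 3 * (w ^ 3 * (A * B * E)) := by
    rw [abs_mul]
    calc _ ≤ A * ((b * w) ^ 3 * B) := by gcongr
      _ = b ^ 3 * (w ^ 3 * (A * B)) := by ring
      _ ≤ _ := by gcongr
  have t3 : |w ^ 3 * (d3 + d4 * w)| ≤ (|d3| + |d4|) * (w ^ 3 * (A * B * E)) := by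
    rw [abs_mul, abs_of_nonneg (by positivity : 0 ≤ w ^ 3)]
    have : |d3 + d4 * w| ≤ |d3| * E + |d4| * E := by
      refine (abs_add_le _ _).trans ?_
      rw [abs_mul, abs_of_nonneg hw]
      gcongr
      nlinarith [abs_nonneg d3]
    calc _ ≤ w ^ 3 * (|d3| * E + |d4| * E) := by gcongr
      _ = (|d3| + |d4|) * (w ^ 3 * E) := by ring
      _ ≤ _ := by gcongr
  linarith

lemma mom0 : IntegrableOn (fun u : ℝ => Real.exp (-u ^ 2)) (Set.Ioi 0) ∧
    ∫ u in Set.Ioi (0 : ℝ), Real.exp (-u ^ 2) = √π / 2 := by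
  have h1 := (integrable_exp_neg_mul_sq one_pos).integrableOn (s := Set.Ioi 0)
  have h2 := integral_gaussian_Ioi 1
  simp only [neg_mul, one_mul, div_one] at h1 h2
  exact ⟨h1, h2⟩

lemma mom1 : IntegrableOn (fun u : ℝ => u * Real.exp (-u ^ 2)) (Set.Ioi 0) ∧
    ∫ u in Set.Ioi (0 : ℝ), u * Real.exp (-u ^ 2) = 1 / 2 := by
  have h1 := integrableOn_rpow_mul_exp_neg_rpow (p := 2) (s := 1) (by norm_num) two_pos
  have h2 := integral_rpow_mul_exp_neg_rpow (p := 2) (q := 1) two_pos (by norm_num)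
  norm_num at h1 h2
  exact ⟨h1, by rw [h2]⟩

lemma mom2 : IntegrableOn (fun u : ℝ => u ^ 2 * Real.exp (-u ^ 2)) (Set.Ioi 0) ∧
    ∫ u in Set.Ioi (0 : ℝ), u ^ 2 * Real.exp (-u ^ 2) = √π / 4 := by
  have h1 := integrableOn_rpow_mul_exp_neg_rpow (p := 2) (s := 2) (by norm_num) two_pos
  have h2 := integral_rpow_mul_exp_neg_rpow (p := 2) (q := 2) two_pos (by norm_num)
  rw [show ((2:ℝ) + 1) / 2 = 1 / 2 + 1 by norm_num, Real.Gamma_add_one (by norm_num),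
    Real.Gamma_one_half_eq] at h2
  norm_num at h1 h2
  exact ⟨h1, by rw [h2]; ring⟩

lemma h_exp (a b : ℝ) (ha : 0 < a) (hb : 0 < b) : ∃ D : ℝ, ∀ x : ℝ, 0 ≤ x → x ≤ 1 →
    |(∫ u in Set.Ioi (0 : ℝ), Real.exp (-u ^ 2) *
        (Real.exp (-(2 * a * (x * u))) * F01reg (b * (x * u))))
      - (√π / 2 + (b - 2 * a) * x / 2 + (b ^ 2 / 4 - 2 * a * b + 2 * a ^ 2) * x ^ 2 * (√π / 4))| ≤
      D * x ^ 3 := by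
  obtain ⟨C, K, hC, hK, hphi⟩ := phi_bd a b ha hb
  set c1 := b - 2 * a
  set c2 := b ^ 2 / 4 - 2 * a * b + 2 * a ^ 2
  set G : ℝ → ℝ := fun u => C * (6 * Real.exp ((K + 1) ^ 2 / 2)) * Real.exp (-(1 / 2) * u ^ 2) with hG
  have hGi : IntegrableOn G (Set.Ioi 0) :=
    ((integrable_exp_neg_mul_sq (by norm_num : (0:ℝ) < 1 / 2)).integrableOn).const_mul _
  refine ⟨∫ u in Set.Ioi (0 : ℝ), G u, fun x hx hx1 => ?_⟩
  set p : ℝ → ℝ := fun u => Real.exp (-u ^ 2) + c1 * x * (u * Real.exp (-u ^ 2))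
    + c2 * x ^ 2 * (u ^ 2 * Real.exp (-u ^ 2)) with hp
  have hpi1 : IntegrableOn (fun u => Real.exp (-u ^ 2) + c1 * x * (u * Real.exp (-u ^ 2))) (Set.Ioi 0) :=
    mom0.1.add (mom1.1.const_mul _)
  have hpi2 : IntegrableOn (fun u => c2 * x ^ 2 * (u ^ 2 * Real.exp (-u ^ 2))) (Set.Ioi 0) :=
    mom2.1.const_mul _
  have hpi : IntegrableOn p (Set.Ioi 0) := hpi1.add hpi2
  have hpint : ∫ u in Set.Ioi (0 : ℝ), p u
      = √π / 2 + c1 * x / 2 + c2 * x ^ 2 * (√π / 4) := by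
    rw [hp, integral_add hpi1 hpi2, integral_add mom0.1 (mom1.1.const_mul _), integral_const_mul,
      integral_const_mul, mom0.2, mom1.2, mom2.2]
    ring
  set f : ℝ → ℝ := fun u => Real.exp (-u ^ 2) *
        (Real.exp (-(2 * a * (x * u))) * F01reg (b * (x * u))) with hf
  have hbd : ∀ u ∈ Set.Ioi (0 : ℝ), ‖f u - p u‖ ≤ G u * x ^ 3 := by
    intro u hu
    have hu : 0 < u := hu
    have h := hphi (x * u) (by positivity)
    have e : f u - p u = Real.exp (-u ^ 2) * (Real.exp (-(2 * a * (x * u))) * F01reg (b * (x * u))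
      - (1 + c1 * (x * u) + c2 * (x * u) ^ 2)) := by
      simp only [hf, hp]; ring
    rw [e, Real.norm_eq_abs, abs_mul, abs_of_pos (Real.exp_pos _)]
    have q1 : Real.exp (K * (x * u)) ≤ Real.exp (K * u) := by
      gcongr
      nlinarith
    have q2 : u ^ 3 ≤ 6 * Real.exp u := by
      have := Real.pow_div_factorial_le_exp u hu.le 3
      norm_num [Nat.factorial] at this
      linarith
    have q3 : Real.exp (-u ^ 2) * (Real.exp u * Real.exp (K * u)) ≤
        Real.exp ((K + 1) ^ 2 / 2) * Real.exp (-(1 / 2) * u ^ 2) := by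
      rw [← Real.exp_add, ← Real.exp_add, ← Real.exp_add]
      refine Real.exp_le_exp.2 ?_
      nlinarith [sq_nonneg (u - (K + 1))]
    calc _ ≤ Real.exp (-u ^ 2) * (C * ((x * u) ^ 3 * Real.exp (K * u))) := by
          gcongr
          refine h.trans ?_
          gcongr
      _ = Real.exp (-u ^ 2) * (C * (x ^ 3 * (u ^ 3 * Real.exp (K * u)))) := by ring
      _ ≤ Real.exp (-u ^ 2) * (C * (x ^ 3 * ((6 * Real.exp u) * Real.exp (K * u)))) := by gcongr
      _ = C * x ^ 3 * 6 * (Real.exp (-u ^ 2) * (Real.exp u * Real.exp (K * u))) := by ring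
      _ ≤ C * x ^ 3 * 6 * (Real.exp ((K + 1) ^ 2 / 2) * Real.exp (-(1 / 2) * u ^ 2)) := by gcongr
      _ = G u * x ^ 3 := by simp only [hG]; ring
  have hfm : Measurable f := by
    have := F_meas
    simp only [hf]
    fun_prop
  have hpm : Measurable p := by
    simp only [hp]
    fun_prop
  have hae : ∀ᵐ u ∂(volume.restrict (Set.Ioi (0 : ℝ))), ‖f u - p u‖ ≤ G u * x ^ 3 :=
    (ae_restrict_mem measurableSet_Ioi).mono hbd
  have hdi : IntegrableOn (fun u => f u - p u) (Set.Ioi 0) :=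
    Integrable.mono' (hGi.mul_const _) (hfm.sub hpm).aestronglyMeasurable hae
  have hfi : IntegrableOn f (Set.Ioi 0) := by
    have := hdi.add hpi
    refine this.congr (Filter.Eventually.of_forall fun u => ?_)
    simp
  rw [← hpint, ← integral_sub hfi hpi, ← Real.norm_eq_abs, ← integral_mul_const]
  exact norm_integral_le_of_norm_le (hGi.mul_const _) hae

set_option maxHeartbeats 1000000 in
theorem stmt_17 (τ : ℝ) (hτ : 0 < τ) :
    (fun ξ : ℝ =>
        (2 / Real.sqrt π) *
            (∫ u in Set.Ioi (0 : ℝ),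
              Real.exp (-(u + ξ / (2 * Real.sqrt τ)) ^ 2) * F01reg (2 * ξ * Real.sqrt τ * u)) -
          (1 + ξ * (2 * τ - 1) / Real.sqrt (π * τ) + (ξ ^ 2 / 2) * (τ - 2))) =O[nhdsWithin 0 (Set.Ici 0)]
      fun ξ : ℝ => ξ ^ 3 := by
  have hs : 0 < √τ := Real.sqrt_pos.2 hτ
  have hp : 0 < √π := Real.sqrt_pos.2 Real.pi_pos
  have hss : √τ ^ 2 = τ := Real.sq_sqrt hτ.le
  set s := √τ with hsdef
  set r := √π with hrdef
  have hsp : √(π * τ) = r * s := Real.sqrt_mul Real.pi_pos.le _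
  set a : ℝ := 1 / (2 * s) with ha
  set b : ℝ := 2 * s with hb
  have ha0 : 0 < a := by positivity
  have hb0 : 0 < b := by positivity
  have hab : a * b = 1 := by rw [ha, hb]; field_simp
  obtain ⟨D, hD⟩ := h_exp a b ha0 hb0
  set c1 := b - 2 * a with hc1
  set c2 := b ^ 2 / 4 - 2 * a * b + 2 * a ^ 2 with hc2
  set M : ℝ := a ^ 4 * Real.exp (a ^ 2) with hM
  -- the polynomial factor
  set L : ℝ := |2 / r * (r / 2)| + |2 / r * (c1 / 2)| + |2 / r * (c2 * (r / 4))| with hL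
  refine IsBigO.of_bound (2 / r * D + M * L + (a ^ 2 * |2 / r * (c1 / 2)| + a ^ 2 * |2 / r * (c2 * (r / 4))|)) ?_
  have hev : ∀ᶠ x : ℝ in nhdsWithin 0 (Set.Ici 0), 0 ≤ x ∧ x ≤ 1 := by
    have h1 : ∀ᶠ x : ℝ in nhdsWithin 0 (Set.Ici 0), x ≤ 1 :=
      nhdsWithin_le_nhds (eventually_le_nhds one_pos)
    filter_upwards [h1, self_mem_nhdsWithin] with x h1 h2 using ⟨h2, h1⟩
  filter_upwards [hev] with x hx
  obtain ⟨hx0, hx1⟩ := hx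
  have hI : (∫ u in Set.Ioi (0 : ℝ),
      Real.exp (-(u + x / (2 * s)) ^ 2) * F01reg (2 * x * s * u))
      = Real.exp (-(a ^ 2 * x ^ 2)) * ∫ u in Set.Ioi (0 : ℝ), Real.exp (-u ^ 2) *
        (Real.exp (-(2 * a * (x * u))) * F01reg (b * (x * u))) := by
    rw [← integral_const_mul]
    congr 1
    ext u
    rw [show 2 * x * s * u = b * (x * u) by rw [hb]; ring,
      show x / (2 * s) = a * x by rw [ha]; ring,
      show -(u + a * x) ^ 2 = -(a ^ 2 * x ^ 2) + (-u ^ 2 + -(2 * a * (x * u))) by ring,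
      Real.exp_add, Real.exp_add]
    ring
  have hDx := hD x hx0 hx1
  rw [hI]
  set J := ∫ u in Set.Ioi (0 : ℝ), Real.exp (-u ^ 2) *
        (Real.exp (-(2 * a * (x * u))) * F01reg (b * (x * u)))
  set e := Real.exp (-(a ^ 2 * x ^ 2)) with he
  have he1 : |e| ≤ 1 := by
    rw [abs_of_pos (Real.exp_pos _), Real.exp_le_one_iff]
    have : 0 ≤ a ^ 2 * x ^ 2 := by positivity
    linarith
  have he2 : |e - (1 - a ^ 2 * x ^ 2)| ≤ M * x ^ 3 := by
    have h := exp_rem 2 (-(a ^ 2 * x ^ 2))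
    rw [abs_neg, abs_of_nonneg (by positivity : 0 ≤ a ^ 2 * x ^ 2)] at h
    norm_num [Finset.sum_range_succ, Nat.factorial] at h
    have h2 : x ^ 2 ≤ 1 := pow_le_one₀ hx0 hx1
    rw [show 1 - a ^ 2 * x ^ 2 = 1 + -(a ^ 2 * x ^ 2) by ring]
    calc _ ≤ _ := h
      _ ≤ (a ^ 2 * x ^ 2) ^ 2 * Real.exp (a ^ 2) := by
        gcongr
        nlinarith [sq_nonneg a]
      _ = a ^ 4 * Real.exp (a ^ 2) * (x ^ 3 * x) := by ring
      _ ≤ a ^ 4 * Real.exp (a ^ 2) * (x ^ 3 * 1) := by gcongr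
      _ = _ := by rw [hM]; ring
  set N := r / 2 + c1 * x / 2 + c2 * x ^ 2 * (r / 4) with hN
  set k1 := 2 / r * (c1 / 2) with hk1
  set k2 := 2 / r * (c2 * (r / 4)) with hk2
  have hr0 : 2 / r * (r / 2) = 1 := by field_simp
  have hNk : 2 / r * N = 1 + k1 * x + k2 * x ^ 2 := by
    rw [hN, hk1, hk2, ← hr0]; ring
  have hgoal : 1 + x * (2 * τ - 1) / √(π * τ) + x ^ 2 / 2 * (τ - 2) = 1 + k1 * x + (k2 - a ^ 2) * x ^ 2 := by
    rw [hsp, hk1, hk2, hc1, hc2, ha, hb, ← hss]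
    field_simp
    ring
  have key : 2 / r * (e * J) - (1 + x * (2 * τ - 1) / √(π * τ) + x ^ 2 / 2 * (τ - 2))
      = 2 / r * (e * (J - N)) + (e - (1 - a ^ 2 * x ^ 2)) * (2 / r * N)
        + -(x ^ 3 * (a ^ 2 * k1 + a ^ 2 * k2 * x)) := by
    rw [hgoal, show 2 / r * (e * (J - N)) = 2 / r * (e * J) - e * (2 / r * N) by ring, hNk]; ring
  have hx2 : x ^ 2 ≤ 1 := pow_le_one₀ hx0 hx1
  have hNb : |2 / r * N| ≤ L := by
    rw [hNk, hL, hr0]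
    refine (abs_add_three _ _ _).trans ?_
    rw [abs_mul k1, abs_mul k2, abs_of_nonneg hx0, abs_of_nonneg (sq_nonneg x)]
    have := mul_le_of_le_one_right (abs_nonneg k1) hx1
    have := mul_le_of_le_one_right (abs_nonneg k2) hx2
    linarith
  have hx3 : 0 ≤ x ^ 3 := by positivity
  rw [key, Real.norm_eq_abs, Real.norm_eq_abs, abs_of_nonneg hx3]
  refine (abs_add_three _ _ _).trans ?_
  have t1 : |2 / r * (e * (J - N))| ≤ 2 / r * D * x ^ 3 := by
    rw [abs_mul, abs_mul, abs_of_pos (by positivity : 0 < 2 / r), mul_assoc]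
    refine mul_le_mul_of_nonneg_left ?_ (by positivity)
    calc _ ≤ 1 * |J - N| := by gcongr
      _ = |J - N| := one_mul _
      _ ≤ _ := hDx
  have t2 : |(e - (1 - a ^ 2 * x ^ 2)) * (2 / r * N)| ≤ M * L * x ^ 3 := by
    rw [abs_mul]
    calc _ ≤ (M * x ^ 3) * L := by gcongr
      _ = _ := by ring
  have t3 : |-(x ^ 3 * (a ^ 2 * k1 + a ^ 2 * k2 * x))| ≤ (a ^ 2 * |k1| + a ^ 2 * |k2|) * x ^ 3 := by
    rw [abs_neg, abs_mul, abs_of_nonneg hx3, mul_comm]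
    gcongr
    refine (abs_add_le _ _).trans ?_
    rw [abs_mul (a ^ 2 * k2) x, abs_mul (a ^ 2) k1, abs_mul (a ^ 2) k2, abs_of_nonneg hx0,
      abs_of_nonneg (sq_nonneg a)]
    have := mul_le_of_le_one_right (by positivity : 0 ≤ a ^ 2 * |k2|) hx1
    linarith
  linarith
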